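/- arXiv:1901.07599 — 3 statements merged into one kernel-verified Lean document; each statement's English description precedes it below -/
import Mathlib

section
/- Let H be a real Hilbert space, let V : H →L[ℝ] H be a compact, self-adjoint, positive continuous linear operator, let β ∈ H, let α ∈ (0,1), and let w₁, …, w_{p−1} ∈ H be given. Let S = {w ∈ H : ‖w‖ = 1 and ⟪w, V wⱼ⟫ = 0 for all j = 1, …, p−1}. If there exists w₀ ∈ S with ⟪β, V w₀⟫ ≠ 0, then there exists w* ∈ S such that T_α(w) ≤ T_α(w*) for every w ∈ S; that is, the continuum criterion T_α attains a maximum on the constraint set S. (Paper's Proposition 1, existence of the functional continuum basis functions, stated in abstract Hilbert-space form.) -/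
open RealInnerProductSpace Filter

/-- The continuum criterion `T_α(w) = ⟪β, V w⟫² ⋅ ⟪w, V w⟫^{α/(1-α) - 1}` when
`⟪w, V w⟫ > 0`, and `0` otherwise. -/
noncomputable def Tcrit {H : Type*} [NormedAddCommGroup H] [InnerProductSpace ℝ H]
    (V : H →L[ℝ] H) (β : H) (α : ℝ) (w : H) : ℝ :=
  if 0 < ⟪w, V w⟫ then ⟪β, V w⟫ ^ 2 * ⟪w, V w⟫ ^ (α / (1 - α) - 1) else 0

open Topology

section WeakConvergence

variable {ι H : Type*} [NormedAddCommGroup H] [InnerProductSpace ℝ H]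

/-- A compact symmetric operator maps bounded weakly convergent families to norm convergent
ones. -/
theorem IsCompactOperator.tendsto_of_tendsto_inner {V : H →L[ℝ] H} (hcpt : IsCompactOperator V)
    (hsa : ∀ x y : H, ⟪V x, y⟫ = ⟪x, V y⟫) {l : Filter ι} {u : ι → H} {w : H} {r : ℝ}
    (hu : ∀ᶠ i in l, ‖u i‖ ≤ r) (hw : ∀ z, Tendsto (fun i => ⟪u i, z⟫) l (𝓝 ⟪w, z⟫)) :
    Tendsto (fun i => V (u i)) l (𝓝 (V w)) := by
  obtain ⟨K, hK, hVK⟩ :=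
    IsCompactOperator.image_closedBall_subset_compact (f := (V : H →ₗ[ℝ] H)) hcpt r
  rw [tendsto_iff_ultrafilter]
  intro g hg
  have hgK : K ∈ g.map (fun i => V (u i)) := by
    have hgu : ∀ᶠ i in (g : Filter ι), ‖u i‖ ≤ r := hg hu
    exact hgu.mono fun i hi => hVK ⟨u i, by simpa using hi, rfl⟩
  obtain ⟨y, -, hy⟩ := hK.ultrafilter_le_nhds' _ hgK
  have hy' : Tendsto (fun i => V (u i)) g (𝓝 y) := hy
  suffices y = V w by rwa [← this]
  refine ext_inner_right ℝ fun z => ?_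
  refine tendsto_nhds_unique (hy'.inner tendsto_const_nhds) ?_
  simp only [hsa]
  exact (hw (V z)).mono_left hg

theorem IsCompactOperator.tendsto_inner_self {V : H →L[ℝ] H} (hcpt : IsCompactOperator V)
    (hsa : ∀ x y : H, ⟪V x, y⟫ = ⟪x, V y⟫) {l : Filter ι} {u : ι → H} {w : H} {r : ℝ}
    (hu : ∀ᶠ i in l, ‖u i‖ ≤ r) (hw : ∀ z, Tendsto (fun i => ⟪u i, z⟫) l (𝓝 ⟪w, z⟫)) :
    Tendsto (fun i => ⟪u i, V (u i)⟫) l (𝓝 ⟪w, V w⟫) := by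
  have hV := hcpt.tendsto_of_tendsto_inner hsa hu hw
  have hsub : Tendsto (fun i => ⟪u i, V (u i) - V w⟫) l (𝓝 0) := by
    have hnorm : Tendsto (fun i => r * ‖V (u i) - V w‖) l (𝓝 0) := by
      simpa using (tendsto_iff_norm_sub_tendsto_zero.1 hV).const_mul r
    refine squeeze_zero_norm' ?_ hnorm
    filter_upwards [hu] with i hi
    exact (norm_inner_le_norm _ _).trans (by gcongr)
  simpa [inner_sub_right] using hsub.add (hw (V w))

end WeakConvergence

section Criterion

variable {ι H : Type*} [NormedAddCommGroup H] [InnerProductSpace ℝ H]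

theorem inner_sq_le_inner_mul_inner_of_nonneg {V : H →L[ℝ] H}
    (hsa : ∀ x y : H, ⟪V x, y⟫ = ⟪x, V y⟫) (hpos : ∀ x : H, 0 ≤ ⟪x, V x⟫) (x y : H) :
    ⟪x, V y⟫ ^ 2 ≤ ⟪x, V x⟫ * ⟪y, V y⟫ := by
  have h : ∀ t : ℝ, 0 ≤ ⟪y, V y⟫ * (t * t) + 2 * ⟪x, V y⟫ * t + ⟪x, V x⟫ := by
    intro t
    have h₁ := hpos (x + t • y)
    have h₂ : ⟪y, V x⟫ = ⟪x, V y⟫ := by rw [← hsa, real_inner_comm]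
    simp only [map_add, map_smul, inner_add_left, inner_add_right, inner_smul_left,
      inner_smul_right, h₂, RCLike.conj_to_real] at h₁
    linarith
  have := discrim_le_zero h
  rw [discrim] at this
  linarith

theorem Tcrit_nonneg (V : H →L[ℝ] H) (β : H) (α : ℝ) (w : H) : 0 ≤ Tcrit V β α w := by
  unfold Tcrit
  split_ifs with h <;> positivity

theorem Tcrit_le {V : H →L[ℝ] H} (hsa : ∀ x y : H, ⟪V x, y⟫ = ⟪x, V y⟫)
    (hpos : ∀ x : H, 0 ≤ ⟪x, V x⟫) (β : H) (α : ℝ) (w : H) :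
    Tcrit V β α w ≤ ⟪β, V β⟫ * ⟪w, V w⟫ ^ (α / (1 - α)) := by
  have hβ := hpos β
  have hw := hpos w
  unfold Tcrit
  split_ifs with h
  · calc
      ⟪β, V w⟫ ^ 2 * ⟪w, V w⟫ ^ (α / (1 - α) - 1)
        ≤ ⟪β, V β⟫ * ⟪w, V w⟫ * ⟪w, V w⟫ ^ (α / (1 - α) - 1) := by
          gcongr
          exact inner_sq_le_inner_mul_inner_of_nonneg hsa hpos β w
      _ = ⟪β, V β⟫ * ⟪w, V w⟫ ^ (α / (1 - α)) := by
          rw [Real.rpow_sub_one h.ne']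
          field_simp
  · positivity

theorem tendsto_Tcrit {V : H →L[ℝ] H} (hcpt : IsCompactOperator V)
    (hsa : ∀ x y : H, ⟪V x, y⟫ = ⟪x, V y⟫) (hpos : ∀ x : H, 0 ≤ ⟪x, V x⟫) (β : H) {α : ℝ}
    (hα : α ∈ Set.Ioo (0 : ℝ) 1) {l : Filter ι} {u : ι → H} {w : H} {r : ℝ}
    (hu : ∀ᶠ i in l, ‖u i‖ ≤ r) (hw : ∀ z, Tendsto (fun i => ⟪u i, z⟫) l (𝓝 ⟪w, z⟫)) :
    Tendsto (fun i => Tcrit V β α (u i)) l (𝓝 (Tcrit V β α w)) := by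
  have hq := hcpt.tendsto_inner_self hsa hu hw
  have hV := hcpt.tendsto_of_tendsto_inner hsa hu hw
  have hexp : 0 < α / (1 - α) := div_pos hα.1 (sub_pos.2 hα.2)
  rcases (hpos w).eq_or_lt with h₀ | h₀
  · have hT : Tcrit V β α w = 0 := by simp [Tcrit, ← h₀]
    rw [hT]
    refine squeeze_zero (fun i => Tcrit_nonneg V β α _)
      (fun i => Tcrit_le hsa hpos β α _) ?_
    rw [← h₀] at hq
    simpa [Real.zero_rpow hexp.ne'] using (hq.rpow_const (Or.inr hexp.le)).const_mul ⟪β, V β⟫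
  · have hlim : Tendsto (fun i => ⟪β, V (u i)⟫ ^ 2 * ⟪u i, V (u i)⟫ ^ (α / (1 - α) - 1)) l
        (𝓝 (Tcrit V β α w)) := by
      rw [Tcrit, if_pos h₀]
      exact ((tendsto_const_nhds.inner hV).pow 2).mul (hq.rpow_const (Or.inl h₀.ne'))
    refine hlim.congr' ?_
    filter_upwards [hq.eventually (lt_mem_nhds h₀)] with i hi
    rw [Tcrit, if_pos hi]

theorem Tcrit_smul (V : H →L[ℝ] H) (β : H) (α : ℝ) (w : H) {c : ℝ} (hc : 0 < c) :
    Tcrit V β α (c • w) = (c ^ 2) ^ (α / (1 - α)) * Tcrit V β α w := by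
  have hq : ⟪c • w, V (c • w)⟫ = c ^ 2 * ⟪w, V w⟫ := by
    simp only [map_smul, inner_smul_left, inner_smul_right, RCLike.conj_to_real]
    ring
  have hc₂ : 0 < c ^ 2 := by positivity
  unfold Tcrit
  rw [hq]
  simp only [mul_pos_iff_of_pos_left hc₂]
  split_ifs with h
  · rw [Real.mul_rpow hc₂.le h.le, Real.rpow_sub_one hc₂.ne', map_smul, inner_smul_right]
    field_simp
  · simp

theorem Tcrit_le_Tcrit_normalize (V : H →L[ℝ] H) (β : H) {α : ℝ} (hα : α ∈ Set.Ioo (0 : ℝ) 1)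
    {w : H} (hw₀ : w ≠ 0) (hw : ‖w‖ ≤ 1) :
    Tcrit V β α w ≤ Tcrit V β α (‖w‖⁻¹ • w) := by
  have hn : 0 < ‖w‖ := norm_pos_iff.2 hw₀
  rw [Tcrit_smul V β α w (inv_pos.2 hn)]
  refine le_mul_of_one_le_left (Tcrit_nonneg V β α w) ?_
  exact Real.one_le_rpow (one_le_pow₀ ((one_le_inv₀ hn).2 hw))
    (div_pos hα.1 (sub_pos.2 hα.2)).le

/-- The criterion attains its maximum over the part of the unit ball orthogonal to a given
family, by weak compactness. -/
theorem exists_forall_Tcrit_le_of_norm_le_one {κ : Type*} [CompleteSpace H] {V : H →L[ℝ] H}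
    (hcpt : IsCompactOperator V) (hsa : ∀ x y : H, ⟪V x, y⟫ = ⟪x, V y⟫)
    (hpos : ∀ x : H, 0 ≤ ⟪x, V x⟫) (β : H) {α : ℝ} (hα : α ∈ Set.Ioo (0 : ℝ) 1) (v : κ → H) :
    ∃ w : H, (‖w‖ ≤ 1 ∧ ∀ j, ⟪w, v j⟫ = 0) ∧
      ∀ x : H, ‖x‖ ≤ 1 → (∀ j, ⟪x, v j⟫ = 0) → Tcrit V β α x ≤ Tcrit V β α w := by
  let R : WeakDual ℝ H → H := fun φ => (InnerProductSpace.toDual ℝ H).symm φ.toStrongDual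
  have hR : ∀ φ z, ⟪R φ, z⟫ = φ z := fun φ z => InnerProductSpace.toDual_symm_apply
  have hRn : ∀ φ, ‖R φ‖ = ‖φ.toStrongDual‖ := fun φ => LinearIsometryEquiv.norm_map _ _
  let C : Set (WeakDual ℝ H) :=
    WeakDual.toStrongDual ⁻¹' Metric.closedBall 0 1 ∩ {φ | ∀ j, φ (v j) = 0}
  have hC : IsCompact C := by
    refine (WeakDual.isCompact_closedBall 0 1).inter_right ?_
    simp only [Set.ofPred_forall]
    exact isClosed_iInter fun j => isClosed_eq (WeakDual.eval_continuous _) continuous_const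
  have hmem : ∀ φ, φ ∈ C ↔ ‖R φ‖ ≤ 1 ∧ ∀ j, ⟪R φ, v j⟫ = 0 := by
    intro φ
    simp only [hR, hRn]
    simp [C]
  have hcont : ContinuousOn (fun φ => Tcrit V β α (R φ)) C := by
    intro φ _
    refine tendsto_Tcrit (r := 1) hcpt hsa hpos β hα ?_ fun z => ?_
    · filter_upwards [self_mem_nhdsWithin] with ψ hψ
      exact ((hmem ψ).1 hψ).1
    · simp only [hR]
      exact (WeakDual.eval_continuous z).continuousWithinAt
  obtain ⟨φ, hφ, hmax⟩ := hC.exists_isMaxOn ⟨0, (hmem 0).2 (by simp [R])⟩ hcont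
  refine ⟨R φ, (hmem φ).1 hφ, fun x hx hxv => ?_⟩
  have hx' : R (InnerProductSpace.toDual ℝ H x).toWeakDual = x := by simp [R]
  have hxC : (InnerProductSpace.toDual ℝ H x).toWeakDual ∈ C :=
    (hmem _).2 (by rw [hx']; exact ⟨hx, hxv⟩)
  simpa only [Set.mem_ofPred_eq, hx'] using hmax hxC

end Criterion

/-- Existence of the functional continuum basis functions (Proposition 1). -/
theorem continuum_criterion_attains_max
    {H : Type*} [NormedAddCommGroup H] [InnerProductSpace ℝ H] [CompleteSpace H]
    (V : H →L[ℝ] H) (hcpt : IsCompactOperator V)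
    (hsa : ∀ x y : H, ⟪V x, y⟫ = ⟪x, V y⟫)
    (hpos : ∀ x : H, 0 ≤ ⟪x, V x⟫)
    (β : H) (α : ℝ) (hα : α ∈ Set.Ioo (0 : ℝ) 1)
    (k : ℕ) (ws : Fin k → H)
    (S : Set H)
    (hS : S = {w : H | ‖w‖ = 1 ∧ ∀ j : Fin k, ⟪w, V (ws j)⟫ = 0})
    (hne : ∃ w₀ ∈ S, ⟪β, V w₀⟫ ≠ 0) :
    ∃ wstar ∈ S, ∀ w ∈ S, Tcrit V β α w ≤ Tcrit V β α wstar := by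
  subst hS
  obtain ⟨w₀, ⟨hw₀n, hw₀⟩, hβ⟩ := hne
  obtain ⟨w, ⟨hwn, hw⟩, hmax⟩ :=
    exists_forall_Tcrit_le_of_norm_le_one hcpt hsa hpos β hα fun j => V (ws j)
  have hq₀ : 0 < ⟪w₀, V w₀⟫ := by
    refine (hpos w₀).lt_of_ne fun h => hβ ?_
    have hcs := inner_sq_le_inner_mul_inner_of_nonneg hsa hpos β w₀
    rw [← h, mul_zero] at hcs
    exact pow_eq_zero_iff two_ne_zero |>.1 (hcs.antisymm (sq_nonneg _))
  have hT₀ : 0 < Tcrit V β α w₀ := by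
    rw [Tcrit, if_pos hq₀]
    positivity
  have hwne : w ≠ 0 := by
    rintro rfl
    have := hmax w₀ hw₀n.le hw₀
    simp [Tcrit] at this hT₀
    linarith
  refine ⟨‖w‖⁻¹ • w, ⟨norm_smul_inv_norm hwne, fun j => ?_⟩, fun x hx => ?_⟩
  · rw [inner_smul_left, hw j, mul_zero]
  · exact (hmax x hx.1.le hx.2).trans (Tcrit_le_Tcrit_normalize V β hα hwne hwn)
end

section
/- Let H be a real Hilbert space, V : H →L[ℝ] H a compact, self-adjoint, positive continuous linear operator, and β ∈ H. Let φ ∈ H be a unit eigenvector of V with eigenvalue λ > 0, and suppose ⟪β, V φ⟫ ≠ 0. Then for every unit vector w ∈ H with ⟪w, V w⟫ < λ, there exists α₀ ∈ (0,1) such that for every α ∈ (α₀, 1), T_α(w) < T_α(φ). (The key inequality proving the paper's Proposition 3: as α → 1, the functional continuum basis functions coincide with the functional principal components.) -/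
open RealInnerProductSpace Filter

theorem tendsto_div_one_sub_sub_one_nhdsLT_one :
    Tendsto (fun α : ℝ => α / (1 - α) - 1) (nhdsWithin 1 (Set.Iio 1)) atTop := by
  have h_inv : Tendsto (fun α : ℝ => (1 - α)⁻¹) (nhdsWithin 1 (Set.Iio 1)) atTop := by
    refine Tendsto.inv_tendsto_nhdsGT_zero (tendsto_nhdsWithin_iff.2 ⟨?_, ?_⟩)
    · have h : Tendsto (fun α : ℝ => 1 - α) (nhds 1) (nhds (1 - 1)) :=
        (continuous_const.sub continuous_id).tendsto 1
      rw [sub_self] at h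
      exact h.mono_left nhdsWithin_le_nhds
    · filter_upwards [self_mem_nhdsWithin] with α hα
      exact sub_pos.2 (Set.mem_Iio.1 hα)
  refine (tendsto_atTop_add_const_right _ (-2) h_inv).congr' ?_
  filter_upwards [self_mem_nhdsWithin] with α hα
  have h_ne : 1 - α ≠ 0 := (sub_pos.2 (Set.mem_Iio.1 hα)).ne'
  field_simp
  ring

theorem eventually_mul_rpow_lt_mul_rpow {a b d : ℝ} (c : ℝ) (ha : 0 < a) (hab : a < b)
    (hd : 0 < d) : ∀ᶠ x : ℝ in atTop, c * a ^ x < d * b ^ x := by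
  have hb : 0 < b := ha.trans hab
  have h_lim : Tendsto (fun x : ℝ => c * (a / b) ^ x) atTop (nhds (c * 0)) :=
    (tendsto_rpow_atTop_of_base_lt_one (a / b) (by linarith [div_pos ha hb])
      ((div_lt_one hb).2 hab)).const_mul c
  rw [mul_zero] at h_lim
  filter_upwards [h_lim.eventually_lt_const hd] with x hx
  rwa [Real.div_rpow ha.le hb.le, ← mul_div_assoc, div_lt_iff₀ (Real.rpow_pos_of_pos hb x)] at hx

theorem eventually_Tcrit_lt {H : Type*} [NormedAddCommGroup H] [InnerProductSpace ℝ H]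
    (V : H →L[ℝ] H) (β : H) {v w : H} (hv : 0 < ⟪v, V v⟫) (hβv : ⟪β, V v⟫ ≠ 0)
    (hwv : ⟪w, V w⟫ < ⟪v, V v⟫) :
    ∀ᶠ α in nhdsWithin (1 : ℝ) (Set.Iio 1), Tcrit V β α w < Tcrit V β α v := by
  have hd : 0 < ⟪β, V v⟫ ^ 2 := by positivity
  simp only [Tcrit, if_pos hv]
  split_ifs with hw
  · exact tendsto_div_one_sub_sub_one_nhdsLT_one.eventually
      (eventually_mul_rpow_lt_mul_rpow _ hw hwv hd)
  · exact Eventually.of_forall fun α => mul_pos hd (Real.rpow_pos_of_pos hv _)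

/-- Key inequality of Proposition 3: as α → 1 the continuum criterion favors the
leading eigenvector. -/
theorem continuum_criterion_eigenvector_dominates
    {H : Type*} [NormedAddCommGroup H] [InnerProductSpace ℝ H] [CompleteSpace H]
    (V : H →L[ℝ] H) (hcpt : IsCompactOperator V)
    (hsa : ∀ x y : H, ⟪V x, y⟫ = ⟪x, V y⟫)
    (hpos : ∀ x : H, 0 ≤ ⟪x, V x⟫)
    (β : H) (φ : H) (lam : ℝ) (hlam : 0 < lam)
    (hφnorm : ‖φ‖ = 1) (heig : V φ = lam • φ)
    (hβφ : ⟪β, V φ⟫ ≠ 0) :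
    ∀ w : H, ‖w‖ = 1 → ⟪w, V w⟫ < lam →
      ∃ α₀ ∈ Set.Ioo (0 : ℝ) 1, ∀ α ∈ Set.Ioo α₀ 1,
        Tcrit V β α w < Tcrit V β α φ := by
  intro w _ hw
  have hφ : ⟪φ, V φ⟫ = lam := by
    rw [heig, inner_smul_right, real_inner_self_eq_norm_sq, hφnorm, one_pow, mul_one]
  have h_ev := eventually_Tcrit_lt V β (hφ.symm ▸ hlam) hβφ (hφ.symm ▸ hw)
  obtain ⟨l, hl, h_sub⟩ :=
    (mem_nhdsLT_iff_exists_mem_Ico_Ioo_subset (one_half_lt_one (α := ℝ))).1 h_ev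
  exact ⟨l, ⟨one_half_pos.trans_le hl.1, hl.2⟩, fun α hα => h_sub hα⟩
end

section
/- Let H be a real Hilbert space, V : H →L[ℝ] H a self-adjoint positive continuous linear operator, and β ∈ H. Suppose w* ∈ H with ⟪w*, V w*⟫ > 0 maximizes the squared-correlation ratio, that is, for every w ∈ H with ⟪w, V w⟫ > 0 one has ⟪β, V w⟫² / ⟪w, V w⟫ ≤ ⟪β, V w*⟫² / ⟪w*, V w*⟫. Then for every w ∈ H with ⟪w, V w*⟫ = 0, one has ⟪β, V w⟫ = 0. (The α = 0 case of functional continuum regression in Section 2.3 of the paper: after the first ordinary-least-squares direction, no further basis element exists, since all V-orthogonal directions are uncorrelated with the response.) -/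
open RealInnerProductSpace Filter

/-- The α = 0 case of functional continuum regression (Section 2.3): after the
OLS direction, all V-orthogonal directions are uncorrelated with the response. -/
theorem ols_direction_exhausts_covariance
    {H : Type*} [NormedAddCommGroup H] [InnerProductSpace ℝ H] [CompleteSpace H]
    (V : H →L[ℝ] H)
    (hsa : ∀ x y : H, ⟪V x, y⟫ = ⟪x, V y⟫)
    (hpos : ∀ x : H, 0 ≤ ⟪x, V x⟫)
    (β : H) (wstar : H) (hg : 0 < ⟪wstar, V wstar⟫)
    (hmax : ∀ w : H, 0 < ⟪w, V w⟫ →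
      ⟪β, V w⟫ ^ 2 / ⟪w, V w⟫ ≤ ⟪β, V wstar⟫ ^ 2 / ⟪wstar, V wstar⟫) :
    ∀ w : H, ⟪w, V wstar⟫ = 0 → ⟪β, V w⟫ = 0 := by
  intro w hw
  have hw' : ⟪wstar, V w⟫ = 0 := by
    rw [← hsa, real_inner_comm, hw]
  set a := ⟪β, V wstar⟫
  set b := ⟪β, V w⟫
  set g := ⟪wstar, V wstar⟫
  set q := ⟪w, V w⟫
  have hq : 0 ≤ q := hpos w
  have key : ∀ s t : ℝ, 0 < s → (s * a + t * b) ^ 2 * g ≤ a ^ 2 * (s ^ 2 * g + t ^ 2 * q) := by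
    intro s t hs
    have hquad : ⟪s • wstar + t • w, V (s • wstar + t • w)⟫ = s ^ 2 * g + t ^ 2 * q := by
      simp only [map_add, map_smul, inner_add_left, inner_add_right, real_inner_smul_left,
        real_inner_smul_right, hw, hw']
      ring
    have hlin : ⟪β, V (s • wstar + t • w)⟫ = s * a + t * b := by
      simp only [map_add, map_smul, inner_add_right, real_inner_smul_right]
      rfl
    have hquad_pos : 0 < s ^ 2 * g + t ^ 2 * q := by positivity
    have h := hmax (s • wstar + t • w) (hquad ▸ hquad_pos)
    rwa [hquad, hlin, div_le_div_iff₀ hquad_pos hg] at h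
  have hprod : a * b * g = 0 := by
    set K := a ^ 2 * q - b ^ 2 * g with hK
    have h := key (K ^ 2 + 1) (a * b * g) (by positivity)
    have hle : (a * b * g) ^ 2 * (2 * K ^ 2 + 2 - K) ≤ 0 := by
      have hexp : (a * b * g) ^ 2 * K = (a * b * g) ^ 2 * (a ^ 2 * q - b ^ 2 * g) := by rw [hK]
      linarith
    have hfac : 0 < 2 * K ^ 2 + 2 - K := by nlinarith [sq_nonneg (K - 1)]
    exact pow_eq_zero_iff two_ne_zero |>.mp
      (le_antisymm (nonpos_of_mul_nonpos_left hle hfac) (sq_nonneg _))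
  rcases mul_eq_zero.mp ((mul_eq_zero.mp hprod).resolve_right hg.ne') with ha | hb
  · have h := key 1 1 one_pos
    rw [ha] at h
    have hle : b ^ 2 * g ≤ 0 := by linarith
    exact pow_eq_zero_iff two_ne_zero |>.mp
      (le_antisymm (nonpos_of_mul_nonpos_left hle hg) (sq_nonneg _))
  · exact hb
end
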